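/- arXiv:1701.02625 — 2 statements merged into one kernel-verified Lean document; each statement's English description precedes it below -/
import Mathlib

section
/- Let (A,B) ∈ ℝ² satisfy (A-1) and (B-1)–(B-3), let R be a random variable independent of (A,B) such that x ↦ x^α P(R > x) is slowly varying. Assume there exists β > 0 with limsup_{h→0⁺} sup_{a∈ℝ} h^{-β} P(a < log A ≤ a + h) < ∞, and E[A^γ] < ∞ for some γ > max{α, α²/β}. Then both I₁(x) = e^{αx} P(max{AR,B} ≤ e^x < AR + B) and I₂(x) = e^{αx} P(AR + B ≤ e^x < max{AR,B}) are O(L(e^x)) as x → ∞. -/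
open MeasureTheory ProbabilityTheory Filter Set

noncomputable section

/-- A measurable function `L : (0,∞) → (0,∞)` is slowly varying:
`L(λx)/L(x) → 1` as `x → ∞` for every `λ > 0`. -/
def SlowlyVarying (L : ℝ → ℝ) : Prop :=
  (∀ x > 0, 0 < L x) ∧ ∀ l : ℝ, 0 < l →
    Filter.Tendsto (fun x => L (l * x) / L x) Filter.atTop (nhds 1)

lemma le_of_le_dyadic {f : ℝ → ℝ} {x₀ K : ℝ} (hx₀ : 0 < x₀)
    (hf : ∀ x, x₀ ≤ x → f (2 * x) ≤ f x) (hK : ∀ x ∈ Icc x₀ (2 * x₀), f x ≤ K) :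
    ∀ x, x₀ ≤ x → f x ≤ K := by
  have key : ∀ n : ℕ, ∀ x, x₀ ≤ x → x ≤ 2 ^ n * (2 * x₀) → f x ≤ K := by
    intro n
    induction n with
    | zero => intro x h1 h2; exact hK x ⟨h1, by simpa using h2⟩
    | succ n ih =>
      intro x h1 h2
      rcases le_total x (2 * x₀) with h | h
      · exact hK x ⟨h1, h⟩
      · have h3 := hf (x / 2) (by linarith)
        rw [mul_div_cancel₀ x two_ne_zero] at h3
        refine h3.trans (ih _ (by linarith) ?_)
        rw [pow_succ] at h2
        linarith
  intro x hx
  obtain ⟨n, hn⟩ := pow_unbounded_of_one_lt (x / (2 * x₀)) (one_lt_two : (1 : ℝ) < 2)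
  exact key n x hx ((div_lt_iff₀ (by positivity)).1 hn).le

/-- Upper Potter-type bound for a regularly varying tail. -/
lemma SlowlyVarying.tail_le {G : ℝ → ℝ} {α ε : ℝ} (hG1 : ∀ x, G x ≤ 1)
    (hsv : SlowlyVarying fun x => x ^ α * G x) (hε : 0 < ε) (hεα : ε < α) :
    ∃ K > 0, ∀ x > 0, G x ≤ K * x ^ (-(α - ε)) := by
  have h1 : (1 : ℝ) < 2 ^ ε := Real.one_lt_rpow one_lt_two hε
  obtain ⟨x₁, hx₁⟩ := eventually_atTop.1 ((hsv.2 2 two_pos).eventually_lt_const h1)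
  set x₀ := max x₁ 1
  have hx₀ : 0 < x₀ := lt_of_lt_of_le one_pos (le_max_right _ _)
  have hp : 0 < α - ε := sub_pos.2 hεα
  have hbd : ∀ x, x₀ ≤ x → x ^ (α - ε) * G x ≤ (2 * x₀) ^ (α - ε) := by
    refine le_of_le_dyadic (f := fun x => x ^ (α - ε) * G x) hx₀ ?_ ?_
    · intro x hx
      have hx0 : 0 < x := hx₀.trans_le hx
      have h2 := hx₁ x ((le_max_left _ _).trans hx)
      have h3 := (div_lt_iff₀ (hsv.1 x hx0)).1 h2
      dsimp only at h3 ⊢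
      rw [Real.mul_rpow two_pos.le hx0.le, Real.rpow_sub two_pos, Real.rpow_sub hx0]
      rw [Real.mul_rpow two_pos.le hx0.le] at h3
      have e1 : (2 : ℝ) ^ α / 2 ^ ε * (x ^ α / x ^ ε) * G (2 * x)
          = (2 ^ α * x ^ α * G (2 * x)) / (2 ^ ε * x ^ ε) := by field_simp
      have e2 : x ^ α / x ^ ε * G x = (2 ^ ε * (x ^ α * G x)) / (2 ^ ε * x ^ ε) := by
        field_simp
      rw [e1, e2]
      gcongr
    · intro x hx
      have hx0 : 0 < x := hx₀.trans_le hx.1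
      calc x ^ (α - ε) * G x ≤ x ^ (α - ε) * 1 := by gcongr; exact hG1 x
        _ ≤ (2 * x₀) ^ (α - ε) := by rw [mul_one]; gcongr; exact hx.2
  refine ⟨(2 * x₀) ^ (α - ε), by positivity, fun x hx => ?_⟩
  have h4 : x ^ (α - ε) * G x ≤ (2 * x₀) ^ (α - ε) := by
    rcases le_total x₀ x with h | h
    · exact hbd x h
    · calc x ^ (α - ε) * G x ≤ x ^ (α - ε) * 1 := by gcongr; exact hG1 x
        _ ≤ (2 * x₀) ^ (α - ε) := by rw [mul_one]; gcongr; linarith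
  rw [Real.rpow_neg hx.le, ← div_eq_mul_inv, le_div_iff₀ (by positivity)]
  linarith

/-- Lower Potter-type bound for a regularly varying antitone tail. -/
lemma SlowlyVarying.le_tail {G : ℝ → ℝ} {α ε : ℝ} (hG : Antitone G) (hα : 0 < α)
    (hsv : SlowlyVarying fun x => x ^ α * G x) (hε : 0 < ε) :
    ∃ c > 0, ∀ᶠ x in atTop, c * x ^ (-(α + ε)) ≤ G x := by
  have h1 : (2 : ℝ) ^ (-ε) < 1 := Real.rpow_lt_one_of_one_lt_of_neg one_lt_two (by linarith)
  obtain ⟨x₁, hx₁⟩ := eventually_atTop.1 ((hsv.2 2 two_pos).eventually_const_lt h1)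
  set x₀ := max x₁ 1
  have hx₀ : 0 < x₀ := lt_of_lt_of_le one_pos (le_max_right _ _)
  have hGpos : ∀ x > 0, 0 < G x := fun x hx =>
    pos_of_mul_pos_right (hsv.1 x hx) (Real.rpow_nonneg hx.le _)
  have hbd : ∀ x, x₀ ≤ x → -(x ^ (α + ε) * G x) ≤ -(x₀ ^ (α + ε) * G (2 * x₀)) := by
    refine le_of_le_dyadic (f := fun x => -(x ^ (α + ε) * G x)) hx₀ ?_ ?_
    · intro x hx
      have hx0 : 0 < x := hx₀.trans_le hx
      have h2 := hx₁ x ((le_max_left _ _).trans hx)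
      have h3 := (lt_div_iff₀ (hsv.1 x hx0)).1 h2
      dsimp only at h3 ⊢
      rw [neg_le_neg_iff, Real.mul_rpow two_pos.le hx0.le, Real.rpow_add two_pos,
        Real.rpow_add hx0]
      rw [Real.mul_rpow two_pos.le hx0.le, Real.rpow_neg two_pos.le] at h3
      have e1 : x ^ α * x ^ ε * G x
          = (2 ^ ε * x ^ ε) * (((2 : ℝ) ^ ε)⁻¹ * (x ^ α * G x)) := by field_simp
      have e2 : (2 : ℝ) ^ α * 2 ^ ε * (x ^ α * x ^ ε) * G (2 * x)
          = (2 ^ ε * x ^ ε) * (2 ^ α * x ^ α * G (2 * x)) := by ring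
      rw [e1, e2]
      gcongr
    · intro x hx
      have hx0 : 0 < x := hx₀.trans_le hx.1
      have := hGpos (2 * x₀) (by positivity)
      rw [neg_le_neg_iff]
      gcongr
      · exact hx.1
      · exact hG hx.2
  refine ⟨x₀ ^ (α + ε) * G (2 * x₀), mul_pos (by positivity) (hGpos _ (by positivity)), ?_⟩
  filter_upwards [eventually_ge_atTop x₀] with x hx
  have hx0 : 0 < x := hx₀.trans_le hx
  have := hbd x hx
  rw [Real.rpow_neg hx0.le, ← div_eq_mul_inv, div_le_iff₀ (by positivity)]
  linarith

/-- Markov's inequality for powers. -/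
lemma measureReal_lt_le_rpow {Ω : Type*} [MeasurableSpace Ω] {μ : Measure Ω}
    [IsProbabilityMeasure μ] {X : Ω → ℝ} {p : ℝ} (hp : 0 < p) (hX : ∀ᵐ ω ∂μ, 0 ≤ X ω)
    (hint : Integrable (fun ω => X ω ^ p) μ) {t : ℝ} (ht : 0 < t) :
    μ.real {ω | t < X ω} ≤ (∫ ω, X ω ^ p ∂μ) * t ^ (-p) := by
  have h0 : 0 ≤ᵐ[μ] fun ω => X ω ^ p := hX.mono fun ω h => Real.rpow_nonneg h _
  have h1 := mul_meas_ge_le_integral_of_nonneg h0 hint (t ^ p)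
  have h2 : μ.real {ω | t < X ω} ≤ μ.real {ω | t ^ p ≤ X ω ^ p} :=
    measureReal_mono fun ω (hω : t < X ω) => Real.rpow_le_rpow ht.le hω.le hp.le
  rw [Real.rpow_neg ht.le, ← div_eq_mul_inv, le_div_iff₀ (by positivity)]
  calc _ ≤ μ.real {ω | t ^ p ≤ X ω ^ p} * t ^ p := by gcongr
    _ ≤ _ := by rw [mul_comm]; exact h1

lemma IndepFun.measure_eq_lintegral {Ω E F : Type*} [MeasurableSpace Ω] [MeasurableSpace E]
    [MeasurableSpace F] {μ : Measure Ω} [IsProbabilityMeasure μ] {X : Ω → E} {Y : Ω → F}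
    (h : IndepFun X Y μ) (hX : Measurable X) (hY : Measurable Y) {S : Set (E × F)}
    (hS : MeasurableSet S) :
    μ {ω | (X ω, Y ω) ∈ S} = ∫⁻ ω, μ {ω' | (X ω, Y ω') ∈ S} ∂μ := by
  have hp := (indepFun_iff_map_prod_eq_prod_map_map hX.aemeasurable hY.aemeasurable).1 h
  have : IsProbabilityMeasure (μ.map Y) := Measure.isProbabilityMeasure_map hY.aemeasurable
  have e1 : μ {ω | (X ω, Y ω) ∈ S} = μ.map (fun ω => (X ω, Y ω)) S :=
    (Measure.map_apply (hX.prodMk hY) hS).symm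
  rw [e1, hp, Measure.prod_apply hS, lintegral_map (measurable_measure_prodMk_left hS) hX]
  refine lintegral_congr fun ω => ?_
  rw [Measure.map_apply hY (measurable_prodMk_left hS)]
  rfl

/-- If the fibres of an event over `Y ∈ T` have probability at most `c`, then the event
intersected with `Y ∈ T` has probability at most `c * P(Y ∈ T)`. -/
lemma IndepFun.measureReal_le_mul {Ω E F : Type*} [MeasurableSpace Ω] [MeasurableSpace E]
    [MeasurableSpace F] {μ : Measure Ω} [IsProbabilityMeasure μ] {X : Ω → E} {Y : Ω → F}
    (h : IndepFun X Y μ) (hX : Measurable X) (hY : Measurable Y) {S : Set (E × F)}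
    (hS : MeasurableSet S) {T : Set E} (hT : MeasurableSet T) {c : ℝ}
    (hc : 0 ≤ c) (hST : ∀ x ∈ T, μ.real {ω | (x, Y ω) ∈ S} ≤ c) :
    μ.real {ω | (X ω, Y ω) ∈ S ∧ X ω ∈ T} ≤ c * μ.real {ω | X ω ∈ T} := by
  have e := IndepFun.measure_eq_lintegral h hX hY (hS.inter (measurable_fst hT))
  have hTm : MeasurableSet {ω | X ω ∈ T} := hX hT
  have h1 : μ {ω | (X ω, Y ω) ∈ S ∧ X ω ∈ T} ≤ ENNReal.ofReal c * μ {ω | X ω ∈ T} := by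
    calc μ {ω | (X ω, Y ω) ∈ S ∧ X ω ∈ T}
        = ∫⁻ ω, μ {ω' | (X ω, Y ω') ∈ S ∩ Prod.fst ⁻¹' T} ∂μ := e
      _ ≤ ∫⁻ ω, {ω | X ω ∈ T}.indicator (fun _ => ENNReal.ofReal c) ω ∂μ := by
        refine lintegral_mono fun ω => ?_
        by_cases hω : X ω ∈ T
        · rw [indicator_of_mem (by exact hω)]
          refine (measure_mono (t := {ω' | (X ω, Y ω') ∈ S}) fun ω' hω' => hω'.1).trans ?_
          rw [← ofReal_measureReal]
          exact ENNReal.ofReal_le_ofReal (hST _ hω)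
        · have : {ω' | (X ω, Y ω') ∈ S ∩ Prod.fst ⁻¹' T} = ∅ := by
            ext ω'; simp [hω]
          rw [this]; simp
      _ = _ := by rw [lintegral_indicator hTm]; simp
  have h2 := ENNReal.toReal_mono (by finiteness) h1
  rwa [ENNReal.toReal_mul, ENNReal.toReal_ofReal hc] at h2

lemma rpow_le_truncation {a M p γ : ℝ} (ha : 0 ≤ a) (hM : 0 < M) (hp : 0 ≤ p) (hpγ : p ≤ γ) :
    a ^ p ≤ M ^ p + M ^ (p - γ) * a ^ γ := by
  have hb : 0 ≤ M ^ (p - γ) * a ^ γ := by positivity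
  rcases le_total a M with h | h
  · have := Real.rpow_le_rpow ha h hp
    linarith
  · have ha' : 0 < a := hM.trans_le h
    have h1 : a ^ p = a ^ (p - γ) * a ^ γ := by rw [← Real.rpow_add ha']; ring_nf
    have h2 : a ^ (p - γ) ≤ M ^ (p - γ) := Real.rpow_le_rpow_of_nonpos hM h (by linarith)
    have h3 : a ^ (p - γ) * a ^ γ ≤ M ^ (p - γ) * a ^ γ := by gcongr
    have : 0 ≤ M ^ p := by positivity
    linarith

/-- Tail of the product `A * R` on an event determined by `B`, where `R` is independent
of `(A, B)` and has a power-bounded tail; the moment of `A` is truncated at level `M`. -/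
lemma measureReal_mul_gt_and_le {Ω : Type*} [MeasurableSpace Ω] {μ : Measure Ω}
    [IsProbabilityMeasure μ] {A B R : Ω → ℝ} (hA : Measurable A) (hB : Measurable B)
    (hR : Measurable R) (hindep : IndepFun (fun ω => (A ω, B ω)) R μ)
    (hApos : ∀ᵐ ω ∂μ, 0 ≤ A ω) {p γ K : ℝ} (hp : 0 < p) (hpγ : p ≤ γ) (hK : 0 ≤ K)
    (hRK : ∀ z > 0, μ.real {ω | z < R ω} ≤ K * z ^ (-p))
    (hAγ : Integrable (fun ω => A ω ^ γ) μ) {D : Set ℝ} (hD : MeasurableSet D)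
    {z M : ℝ} (hz : 0 < z) (hM : 0 < M) :
    μ.real {ω | z < A ω * R ω ∧ B ω ∈ D} ≤
      K * z ^ (-p) * (M ^ p * μ.real {ω | B ω ∈ D} + M ^ (p - γ) * ∫ ω, A ω ^ γ ∂μ) := by
  have hDm : MeasurableSet {ω | B ω ∈ D} := hB hD
  set g : Ω → ℝ := fun ω => K * z ^ (-p) *
    (M ^ p * {ω | B ω ∈ D}.indicator (fun _ => (1 : ℝ)) ω + M ^ (p - γ) * A ω ^ γ) with hg
  have hi : Integrable ({ω | B ω ∈ D}.indicator (fun _ => (1 : ℝ))) μ :=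
    (integrable_const _).indicator hDm
  have hgi : Integrable g μ := ((hi.const_mul _).add (hAγ.const_mul _)).const_mul _
  have hg0 : ∀ᵐ ω ∂μ, 0 ≤ g ω := by
    filter_upwards [hApos] with ω hω
    have : 0 ≤ {ω | B ω ∈ D}.indicator (fun _ => (1 : ℝ)) ω :=
      indicator_nonneg (fun _ _ => zero_le_one) _
    simp only [hg]
    positivity
  have hgint : ∫ ω, g ω ∂μ =
      K * z ^ (-p) * (M ^ p * μ.real {ω | B ω ∈ D} + M ^ (p - γ) * ∫ ω, A ω ^ γ ∂μ) := by
    simp only [hg]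
    rw [integral_const_mul, integral_add (hi.const_mul _) (hAγ.const_mul _),
      integral_const_mul, integral_const_mul, integral_indicator hDm]
    simp
  have hS : MeasurableSet {q : (ℝ × ℝ) × ℝ | z < q.1.1 * q.2 ∧ q.1.2 ∈ D} :=
    (measurableSet_lt (f := fun _ : (ℝ × ℝ) × ℝ => z) (g := fun q => q.1.1 * q.2)
      measurable_const (by fun_prop)).inter ((measurable_snd.comp measurable_fst) hD)
  have e := IndepFun.measure_eq_lintegral hindep (hA.prodMk hB) hR hS
  have h1 : μ {ω | z < A ω * R ω ∧ B ω ∈ D} ≤ ENNReal.ofReal (∫ ω, g ω ∂μ) := by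
    rw [ofReal_integral_eq_lintegral_ofReal hgi hg0]
    refine e.le.trans (lintegral_mono_ae ?_)
    filter_upwards [hApos, hg0] with ω hω hgω
    by_cases hcase : B ω ∈ D ∧ 0 < A ω
    · obtain ⟨hBD, hApos'⟩ := hcase
      refine (measure_mono (t := {ω' | z / A ω < R ω'}) ?_).trans ?_
      · intro ω' hω'
        exact (div_lt_iff₀' hApos').2 hω'.1
      · rw [← ofReal_measureReal]
        refine ENNReal.ofReal_le_ofReal ((hRK _ (by positivity)).trans ?_)
        simp only [hg]
        rw [indicator_of_mem (by exact hBD), mul_one, Real.div_rpow hz.le hω,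
          Real.rpow_neg hω, div_inv_eq_mul, ← mul_assoc]
        gcongr
        exact rpow_le_truncation hω hM hp.le hpγ
    · have : {ω' | z < A ω * R ω' ∧ B ω ∈ D} = ∅ := by
        refine eq_empty_of_forall_notMem ?_
        rintro ω' ⟨h2, h3⟩
        have h4 : A ω = 0 := le_antisymm (not_lt.1 fun h => hcase ⟨h3, h⟩) hω
        rw [h4, zero_mul] at h2
        exact absurd h2 hz.not_gt
      exact (measure_mono_null this.le measure_empty).le.trans zero_le
  have h2 := ENNReal.toReal_mono (by finiteness) h1
  rw [ENNReal.toReal_ofReal (integral_nonneg_of_ae hg0), hgint] at h2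
  exact h2

/-- Concentration of `log A` on short intervals, transferred to `A * r`. -/
lemma measureReal_window_le {Ω : Type*} [MeasurableSpace Ω] {μ : Measure Ω}
    [IsProbabilityMeasure μ] {A : Ω → ℝ} {β C h₀ : ℝ}
    (hcond : ∀ h ∈ Ioc (0 : ℝ) h₀, ∀ a : ℝ,
      (μ {ω | a < Real.log (A ω) ∧ Real.log (A ω) ≤ a + h}).toReal ≤ C * h ^ β)
    {y u r : ℝ} (hy : 0 < y) (hu : 0 < u) (hu2 : u ≤ 1 / 2) (huh : 4 * u ≤ h₀) (hr : 0 < r) :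
    μ.real {ω | y * (1 - u) < A ω * r ∧ A ω * r ≤ y * (1 + u)} ≤ C * (4 * u) ^ β := by
  refine le_trans ?_ (hcond (4 * u) ⟨by positivity, huh⟩ (Real.log (y * (1 - u) / r)))
  have h1u : 0 < 1 - u := by linarith
  refine measureReal_mono fun ω hω => ?_
  obtain ⟨h1, h2⟩ := hω
  have hpos : 0 < y * (1 - u) / r := by positivity
  have h1' : y * (1 - u) / r < A ω := (div_lt_iff₀ hr).2 h1
  have h2' : A ω ≤ y * (1 + u) / r := (le_div_iff₀ hr).2 h2
  refine ⟨Real.log_lt_log hpos h1', (Real.log_le_log (hpos.trans h1') h2').trans ?_⟩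
  rw [Real.log_div (by positivity) hr.ne', Real.log_div (by positivity) hr.ne',
    Real.log_mul hy.ne' h1u.ne', Real.log_mul hy.ne' (by positivity)]
  have l1 := Real.log_le_sub_one_of_pos (show 0 < 1 + u by positivity)
  have l2 := Real.log_le_sub_one_of_pos (inv_pos.2 h1u)
  rw [Real.log_inv] at l2
  have l3 : (1 - u)⁻¹ ≤ 1 + 2 * u := by
    rw [inv_le_iff_one_le_mul₀ h1u]
    nlinarith
  linarith

/-- The event that `A * R` is large and `|B|` is not too small is negligible. -/
lemma exists_measureReal_mul_gt_abs_gt_le {Ω : Type*} [MeasurableSpace Ω] {μ : Measure Ω}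
    [IsProbabilityMeasure μ] {A B R : Ω → ℝ} (hA : Measurable A) (hB : Measurable B)
    (hR : Measurable R) (hindep : IndepFun (fun ω => (A ω, B ω)) R μ)
    (hApos : ∀ᵐ ω ∂μ, 0 ≤ A ω) {α γ ε σ K K' : ℝ} (hεα : ε < α) (hαγ : α < γ)
    (hσ : 0 < σ) (hε : 0 < ε) (hε1 : ε ≤ σ * α / 8) (hε2 : 2 * ε ≤ σ * (γ - α) / 4)
    (hK : 0 ≤ K) (hRK : ∀ z > 0, μ.real {ω | z < R ω} ≤ K * z ^ (-(α - ε)))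
    (hK' : 0 ≤ K') (hBK : ∀ z > 0, μ.real {ω | z < |B ω|} ≤ K' * z ^ (-(α / 2)))
    (hAγ : Integrable (fun ω => A ω ^ γ) μ) :
    ∃ N, ∀ y ≥ 1, μ.real {ω | y / 2 < A ω * R ω ∧ y ^ σ < |B ω|} ≤ N * y ^ (-(α + ε)) := by
  set m := ∫ ω, A ω ^ γ ∂μ
  have hm : 0 ≤ m := integral_nonneg_of_ae (hApos.mono fun ω h => Real.rpow_nonneg h _)
  refine ⟨K * 2 ^ (α - ε) * (K' + m), fun y hy => ?_⟩
  have hy0 : 0 < y := by linarith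
  have hD : MeasurableSet {b : ℝ | y ^ σ < |b|} := measurableSet_lt measurable_const (by fun_prop)
  have h1 := measureReal_mul_gt_and_le hA hB hR hindep hApos (sub_pos.2 hεα)
    (by linarith : α - ε ≤ γ) hK hRK hAγ hD (half_pos hy0)
    (Real.rpow_pos_of_pos hy0 (σ / 4))
  refine h1.trans ?_
  have h2 := hBK (y ^ σ) (by positivity)
  have e1 : (y / 2) ^ (-(α - ε)) = 2 ^ (α - ε) * y ^ (-(α - ε)) := by
    rw [Real.div_rpow hy0.le two_pos.le, Real.rpow_neg two_pos.le, div_inv_eq_mul, mul_comm]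
  have b1 : (y ^ (σ / 4)) ^ (α - ε) * (y ^ σ) ^ (-(α / 2)) ≤ y ^ (-(2 * ε)) := by
    rw [← Real.rpow_mul hy0.le, ← Real.rpow_mul hy0.le, ← Real.rpow_add hy0]
    refine Real.rpow_le_rpow_of_exponent_le hy ?_
    nlinarith
  have b2 : (y ^ (σ / 4)) ^ (α - ε - γ) ≤ y ^ (-(2 * ε)) := by
    rw [← Real.rpow_mul hy0.le]
    refine Real.rpow_le_rpow_of_exponent_le hy ?_
    nlinarith
  have e2 : y ^ (-(α + ε)) = y ^ (-(α - ε)) * y ^ (-(2 * ε)) := by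
    rw [← Real.rpow_add hy0]; ring_nf
  calc K * (y / 2) ^ (-(α - ε)) * ((y ^ (σ / 4)) ^ (α - ε) * μ.real {ω | y ^ σ < |B ω|}
        + (y ^ (σ / 4)) ^ (α - ε - γ) * m)
      ≤ K * (y / 2) ^ (-(α - ε)) *
        ((y ^ (σ / 4)) ^ (α - ε) * (K' * (y ^ σ) ^ (-(α / 2))) + y ^ (-(2 * ε)) * m) := by
        gcongr
    _ = K * (y / 2) ^ (-(α - ε)) *
        (K' * ((y ^ (σ / 4)) ^ (α - ε) * (y ^ σ) ^ (-(α / 2))) + y ^ (-(2 * ε)) * m) := by ring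
    _ ≤ K * (y / 2) ^ (-(α - ε)) * (K' * y ^ (-(2 * ε)) + y ^ (-(2 * ε)) * m) := by gcongr
    _ = _ := by rw [e1, e2]; ring

/-- The event that `A * R` falls into a short window around `y` is negligible. -/
lemma exists_measureReal_mul_window_le {Ω : Type*} [MeasurableSpace Ω] {μ : Measure Ω}
    [IsProbabilityMeasure μ] {A R : Ω → ℝ} (hA : Measurable A)
    (hR : Measurable R) (hindep : IndepFun R A μ)
    (hApos : ∀ᵐ ω ∂μ, 0 ≤ A ω) {α β γ ε σ s K C h₀ : ℝ} (hγ : 0 < γ)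
    (hσ1 : σ < 1) (hε : 0 < ε) (hs : 0 < s)
    (hε1 : α + ε ≤ s * γ) (hε2 : 2 * ε ≤ (1 - σ) * β - s * α)
    (hRK : ∀ z > 0, μ.real {ω | z < R ω} ≤ K * z ^ (-(α - ε)))
    (hC : 0 < C) (hh₀ : 0 < h₀) (hcond : ∀ h ∈ Ioc (0 : ℝ) h₀, ∀ a : ℝ,
      (μ {ω | a < Real.log (A ω) ∧ Real.log (A ω) ≤ a + h}).toReal ≤ C * h ^ β)
    (hK : 0 ≤ K) (hAγ : Integrable (fun ω => A ω ^ γ) μ) :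
    ∃ N, ∀ᶠ y in atTop, μ.real {ω | y * (1 - y ^ (σ - 1)) < A ω * R ω ∧
      A ω * R ω ≤ y * (1 + y ^ (σ - 1))} ≤ N * y ^ (-(α + ε)) := by
  set m := ∫ ω, A ω ^ γ ∂μ
  have hm : 0 ≤ m := integral_nonneg_of_ae (hApos.mono fun ω h => Real.rpow_nonneg h _)
  refine ⟨m * 2 ^ γ + C * 4 ^ β * K, ?_⟩
  have hlim : Tendsto (fun y : ℝ => y ^ (σ - 1)) atTop (nhds 0) := by
    have := tendsto_rpow_neg_atTop (sub_pos.2 hσ1)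
    simpa using this
  filter_upwards [eventually_ge_atTop 1, hlim.eventually_le_const (half_pos one_pos),
    hlim.eventually_le_const (show 0 < h₀ / 4 by positivity)] with y hy hu2 huh
  have hy0 : 0 < y := by linarith
  set u := y ^ (σ - 1) with hu_def
  have hu : 0 < u := by positivity
  have hS : MeasurableSet {q : ℝ × ℝ | y * (1 - u) < q.2 * q.1 ∧ q.2 * q.1 ≤ y * (1 + u)} :=
    (measurableSet_lt (f := fun _ : ℝ × ℝ => y * (1 - u)) (g := fun q => q.2 * q.1)
      measurable_const (by fun_prop)).inter
    (measurableSet_le (f := fun q : ℝ × ℝ => q.2 * q.1) (g := fun _ => y * (1 + u))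
      (by fun_prop) measurable_const)
  have hT : 0 < y ^ (1 - s) := by positivity
  have h1 := IndepFun.measureReal_le_mul hindep hR hA hS (measurableSet_Ioi (a := y ^ (1 - s)))
    (show 0 ≤ C * (4 * u) ^ β by positivity) fun r hr =>
      measureReal_window_le hcond hy0 hu hu2 (by linarith) (hT.trans hr)
  have h2 := measureReal_lt_le_rpow hγ hApos hAγ (show 0 < y ^ s / 2 by positivity)
  have hsub : μ.real {ω | y * (1 - u) < A ω * R ω ∧ A ω * R ω ≤ y * (1 + u)} ≤
      μ.real ({ω | y ^ s / 2 < A ω} ∪ {ω | (R ω, A ω) ∈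
        {q : ℝ × ℝ | y * (1 - u) < q.2 * q.1 ∧ q.2 * q.1 ≤ y * (1 + u)} ∧
          R ω ∈ Ioi (y ^ (1 - s))}) := by
    refine ENNReal.toReal_mono (by finiteness) (measure_mono_ae ?_)
    filter_upwards [hApos] with ω hω hw
    by_cases hr : y ^ (1 - s) < R ω
    · exact Or.inr ⟨hw, hr⟩
    · refine Or.inl ?_
      have h3 : y / 2 < A ω * y ^ (1 - s) := by
        have h4 : A ω * R ω ≤ A ω * y ^ (1 - s) := by gcongr; exact not_lt.1 hr
        have h5 : y * (1 / 2) ≤ y * (1 - u) := by gcongr; linarith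
        linarith [hw.1]
      have h6 : y = y ^ s * y ^ (1 - s) := by
        rw [← Real.rpow_add hy0]; simp
      have h7 : y ^ s / 2 * y ^ (1 - s) < A ω * y ^ (1 - s) := by
        rw [div_mul_eq_mul_div, ← h6]; exact h3
      exact lt_of_mul_lt_mul_right h7 hT.le
  have b1 : (y ^ s / 2) ^ (-γ) ≤ 2 ^ γ * y ^ (-(α + ε)) := by
    rw [Real.div_rpow (by positivity) two_pos.le, Real.rpow_neg two_pos.le, div_inv_eq_mul,
      mul_comm, ← Real.rpow_mul hy0.le]
    gcongr
    linarith
  have b2 : u ^ β * (y ^ (1 - s)) ^ (-(α - ε)) ≤ y ^ (-(α + ε)) := by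
    rw [hu_def, ← Real.rpow_mul hy0.le, ← Real.rpow_mul hy0.le, ← Real.rpow_add hy0]
    refine Real.rpow_le_rpow_of_exponent_le hy ?_
    nlinarith [mul_pos hs hε]
  calc _ ≤ _ := hsub
    _ ≤ _ := measureReal_union_le _ _
    _ ≤ m * (2 ^ γ * y ^ (-(α + ε))) + C * (4 * u) ^ β * (K * (y ^ (1 - s)) ^ (-(α - ε))) := by
      refine add_le_add (h2.trans (by gcongr)) (h1.trans ?_)
      gcongr
      exact hRK _ hT
    _ = m * (2 ^ γ * y ^ (-(α + ε))) +
        C * 4 ^ β * K * (u ^ β * (y ^ (1 - s)) ^ (-(α - ε))) := by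
      rw [Real.mul_rpow (by norm_num) hu.le]; ring
    _ ≤ m * (2 ^ γ * y ^ (-(α + ε))) + C * 4 ^ β * K * y ^ (-(α + ε)) := by gcongr
    _ = _ := by ring

/-- Under (A-1), (B-1)–(B-3), with `R` independent of `(A,B)`,
`x ↦ x^α P(R > x)` slowly varying, a Hölder-type regularity of the law of `log A` and
`E[A^γ] < ∞` for some `γ > max{α, α²/β}`, the functions
`I₁(x) = e^{αx} P(max{AR,B} ≤ e^x < AR+B)` and `I₂(x) = e^{αx} P(AR+B ≤ e^x < max{AR,B})`
are `O(L(e^x))` as `x → ∞`. -/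
theorem perpetuity_I1_I2_bigO
    {Ω : Type*} [MeasurableSpace Ω] (μ : Measure Ω) [IsProbabilityMeasure μ]
    (A B R : Ω → ℝ)
    (hAmeas : Measurable A) (hBmeas : Measurable B) (hRmeas : Measurable R)
    (hindep : IndepFun (fun ω => (A ω, B ω)) R μ)
    -- (A-1)
    (hApos : ∀ᵐ ω ∂μ, 0 ≤ A ω)
    (hlogAint : Integrable (fun ω => Real.log (A ω)) μ)
    (hlogAneg : (∫ ω, Real.log (A ω) ∂μ) < 0)
    (α : ℝ) (hα : 0 < α)
    -- (B-1)
    (L : ℝ → ℝ) (hLdef : ∀ x, L x = x ^ α * (μ {ω | x < B ω}).toReal)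
    (hL : SlowlyVarying L)
    -- (B-2)
    (hBinf : ¬ Integrable (fun ω => max (B ω) 0 ^ α) μ)
    -- (B-3)
    (hBneg : ∀ η ∈ Set.Ioo (0:ℝ) α, Integrable (fun ω => max (-B ω) 0 ^ (α - η)) μ)
    -- x ↦ x^α P(R > x) is slowly varying
    (hRL : SlowlyVarying (fun x => x ^ α * (μ {ω | x < R ω}).toReal))
    -- regularity of the law of log A:
    -- limsup_{h→0⁺} sup_{a∈ℝ} h^{-β} P(a < log A ≤ a + h) < ∞
    (β : ℝ) (hβ : 0 < β)
    (hcond : ∃ C > (0:ℝ), ∃ h₀ > (0:ℝ), ∀ h ∈ Set.Ioc (0:ℝ) h₀, ∀ a : ℝ,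
      (μ {ω | a < Real.log (A ω) ∧ Real.log (A ω) ≤ a + h}).toReal ≤ C * h ^ β)
    (γ : ℝ) (hγ : max α (α ^ 2 / β) < γ)
    (hAγ : Integrable (fun ω => A ω ^ γ) μ) :
    ((fun x => Real.exp (α * x) *
        (μ {ω | max (A ω * R ω) (B ω) ≤ Real.exp x ∧
          Real.exp x < A ω * R ω + B ω}).toReal)
      =O[atTop] fun x => L (Real.exp x)) ∧
    ((fun x => Real.exp (α * x) *
        (μ {ω | A ω * R ω + B ω ≤ Real.exp x ∧
          Real.exp x < max (A ω * R ω) (B ω)}).toReal)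
      =O[atTop] fun x => L (Real.exp x)) := by
  obtain ⟨C, hC, h₀, hh₀, hcond⟩ := hcond
  have hαγ : α < γ := (le_max_left _ _).trans_lt hγ
  have hγ0 : 0 < γ := hα.trans hαγ
  have hsγ : α / γ < β / α := by
    have h := (div_lt_iff₀ hβ).1 ((le_max_right _ _).trans_lt hγ)
    rw [div_lt_div_iff₀ hγ0 hα]
    nlinarith
  obtain ⟨s, hs1, hs2⟩ := exists_between hsγ
  rw [div_lt_iff₀ hγ0] at hs1
  rw [lt_div_iff₀ hα] at hs2
  have hs : 0 < s := pos_of_mul_pos_left (hα.trans hs1) hγ0.le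
  obtain ⟨σ, hσ0, hσ⟩ := exists_between (sub_pos.2 ((div_lt_one hβ).2 hs2))
  have hσ1 : σ < 1 := by
    have : 0 < s * α / β := by positivity
    linarith
  have hσs : 0 < (1 - σ) * β - s * α := by
    have : s * α / β < 1 - σ := by linarith
    linarith [(div_lt_iff₀ hβ).1 this]
  have hγα : 0 < γ - α := sub_pos.2 hαγ
  obtain ⟨ε, hε, hε'⟩ := exists_between (show 0 < min (min α (σ * α / 8))
    (min (σ * (γ - α) / 8) (min (s * γ - α) (((1 - σ) * β - s * α) / 2))) by
      have : 0 < s * γ - α := by linarith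
      simp only [lt_min_iff]
      refine ⟨⟨?_, ?_⟩, ?_, ?_, ?_⟩ <;> positivity)
  simp only [lt_min_iff] at hε'
  obtain ⟨⟨hε1, hε2⟩, hε3, hε4, hε5⟩ := hε'
  have hLB : SlowlyVarying fun x => x ^ α * μ.real {ω | x < B ω} := by
    rwa [show L = fun x => x ^ α * μ.real {ω | x < B ω} from funext hLdef] at hL
  have hanti : Antitone fun x => μ.real {ω | x < B ω} := fun x x' h =>
    measureReal_mono fun ω (hω : x' < B ω) => h.trans_lt hω
  obtain ⟨K, hK, hRK⟩ := SlowlyVarying.tail_le (G := fun x => μ.real {ω | x < R ω})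
    (fun _ => measureReal_le_one) hRL hε hε1
  obtain ⟨K₁, hK₁, hBK₁⟩ := SlowlyVarying.tail_le (G := fun x => μ.real {ω | x < B ω})
    (fun _ => measureReal_le_one) hLB (half_pos hα) (half_lt_self hα)
  have hBneg' := hBneg (α / 2) ⟨half_pos hα, half_lt_self hα⟩
  rw [sub_half] at hBneg'
  simp only [sub_half] at hBK₁
  set K₂ := ∫ ω, max (-B ω) 0 ^ (α / 2) ∂μ
  have hK₂ : 0 ≤ K₂ := integral_nonneg fun ω => by positivity
  have hBK : ∀ z > 0, μ.real {ω | z < |B ω|} ≤ (K₁ + K₂) * z ^ (-(α / 2)) := by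
    intro z hz
    have h1 := measureReal_lt_le_rpow (μ := μ) (half_pos hα)
      (Eventually.of_forall fun ω => le_max_right (-B ω) 0) hBneg' hz
    have h2 : {ω | z < |B ω|} ⊆ {ω | z < B ω} ∪ {ω | z < max (-B ω) 0} := by
      intro ω hω
      rcases lt_abs.1 (show z < |B ω| from hω) with h | h
      · exact Or.inl h
      · exact Or.inr (lt_max_of_lt_left h)
    calc _ ≤ _ := measureReal_mono h2
      _ ≤ _ := measureReal_union_le _ _
      _ ≤ _ := add_le_add (hBK₁ z hz) h1
      _ = _ := by ring
  obtain ⟨N₁, hN₁⟩ := exists_measureReal_mul_gt_abs_gt_le hAmeas hBmeas hRmeas hindep hApos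
    hε1 hαγ hσ0 hε hε2.le (by linarith) hK.le hRK (by positivity) hBK hAγ
  have hindep' : IndepFun R A μ := hindep.symm.comp measurable_id measurable_fst
  obtain ⟨N₂, hN₂⟩ := exists_measureReal_mul_window_le hAmeas hRmeas hindep' hApos hγ0 hσ1
    hε hs (by linarith) (by linarith) hRK hC hh₀ hcond hK.le hAγ
  obtain ⟨c, hc, hBc⟩ := SlowlyVarying.le_tail hanti hα hLB hε
  have hhalf : ∀ᶠ y in atTop, μ.real {ω | y / 2 < B ω} ≤
      2 * 2 ^ α * μ.real {ω | y < B ω} := by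
    filter_upwards [(hLB.2 (1 / 2) (by norm_num)).eventually_lt_const one_lt_two,
      eventually_gt_atTop 0] with y hy hy0
    have h1 := (div_lt_iff₀ (hLB.1 y hy0)).1 hy
    rw [one_div_mul_eq_div, Real.div_rpow hy0.le two_pos.le, div_mul_eq_mul_div,
      div_lt_iff₀ (by positivity)] at h1
    refine le_of_mul_le_mul_left ?_ (Real.rpow_pos_of_pos hy0 α)
    linarith
  have hcore : ∀ᶠ y in atTop, ∀ E : Set Ω, E ⊆ {ω | y / 2 < B ω} ∪
      ({ω | y / 2 < A ω * R ω ∧ y ^ σ < |B ω|} ∪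
        {ω | y * (1 - y ^ (σ - 1)) < A ω * R ω ∧ A ω * R ω ≤ y * (1 + y ^ (σ - 1))}) →
      μ.real E ≤ (2 * 2 ^ α + (|N₁| + |N₂|) / c) * μ.real {ω | y < B ω} := by
    filter_upwards [hhalf, hBc, hN₂, eventually_ge_atTop 1] with y h1 h2 h3 hy E hE
    have h4 := hN₁ y hy
    have hy0 : 0 < y := by linarith
    have hpow : y ^ (-(α + ε)) ≤ μ.real {ω | y < B ω} / c := by
      rw [le_div_iff₀ hc]; linarith
    calc μ.real E ≤ _ := measureReal_mono hE
      _ ≤ _ := measureReal_union_le _ _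
      _ ≤ _ := add_le_add_right (measureReal_union_le _ _) _
      _ ≤ 2 * 2 ^ α * μ.real {ω | y < B ω} +
          (|N₁| * y ^ (-(α + ε)) + |N₂| * y ^ (-(α + ε))) := by
        refine add_le_add h1 (add_le_add (h4.trans ?_) (h3.trans ?_))
        · gcongr; exact le_abs_self _
        · gcongr; exact le_abs_self _
      _ ≤ 2 * 2 ^ α * μ.real {ω | y < B ω} +
          (|N₁| * (μ.real {ω | y < B ω} / c) + |N₂| * (μ.real {ω | y < B ω} / c)) := by gcongr
      _ = _ := by ring
  have hbigO : ∀ E : ℝ → Set Ω, (∀ y ≥ 1, E y ⊆ {ω | y / 2 < B ω} ∪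
      ({ω | y / 2 < A ω * R ω ∧ y ^ σ < |B ω|} ∪
        {ω | y * (1 - y ^ (σ - 1)) < A ω * R ω ∧ A ω * R ω ≤ y * (1 + y ^ (σ - 1))})) →
      (fun x => Real.exp (α * x) * (μ (E (Real.exp x))).toReal)
        =O[atTop] fun x => L (Real.exp x) := by
    intro E hE
    refine Asymptotics.IsBigO.of_bound (2 * 2 ^ α + (|N₁| + |N₂|) / c) ?_
    filter_upwards [Real.tendsto_exp_atTop.eventually hcore,
      Real.tendsto_exp_atTop.eventually_ge_atTop 1] with x hx hx1
    have h1 := hx _ (hE _ hx1)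
    rw [Real.norm_of_nonneg (by positivity), Real.norm_of_nonneg (hL.1 _ (Real.exp_pos x)).le,
      hLdef, ← Real.exp_mul, mul_comm x α]
    calc _ ≤ Real.exp (α * x) * ((2 * 2 ^ α + (|N₁| + |N₂|) / c) *
          μ.real {ω | Real.exp x < B ω}) := by gcongr; exact h1
      _ = _ := by rw [measureReal_def]; ring
  have hyσ : ∀ y : ℝ, 1 ≤ y → y * y ^ (σ - 1) = y ^ σ := fun y hy => by
    rw [mul_comm, ← Real.rpow_add_one (by positivity)]; ring_nf
  refine ⟨hbigO (fun y => {ω | max (A ω * R ω) (B ω) ≤ y ∧ y < A ω * R ω + B ω}) ?_,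
    hbigO (fun y => {ω | A ω * R ω + B ω ≤ y ∧ y < max (A ω * R ω) (B ω)}) ?_⟩
  · rintro y hy ω ⟨h1, h2⟩
    rw [max_le_iff] at h1
    have hyu := hyσ y hy
    have hpos : 0 ≤ y ^ σ := by positivity
    by_cases hB1 : y / 2 < B ω
    · exact Or.inl hB1
    by_cases hB2 : y ^ σ < |B ω|
    · exact Or.inr (Or.inl ⟨by linarith, hB2⟩)
    · have hb := abs_le.1 (not_lt.1 hB2)
      exact Or.inr (Or.inr ⟨by linarith, by linarith⟩)
  · rintro y hy ω ⟨h1, h2⟩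
    have hyu := hyσ y hy
    have hpos : 0 ≤ y ^ σ := by positivity
    by_cases hB1 : y / 2 < B ω
    · exact Or.inl hB1
    have hAR : y < A ω * R ω := (lt_max_iff.1 h2).resolve_right (by linarith)
    by_cases hB2 : y ^ σ < |B ω|
    · exact Or.inr (Or.inl ⟨by linarith, hB2⟩)
    · have hb := abs_le.1 (not_lt.1 hB2)
      exact Or.inr (Or.inr ⟨by linarith, by linarith⟩)
end
end

section
/- Let A, B be real random variables and α > 0. Suppose there is a locally bounded function L₁: (0,∞) → (0,∞) with P(|B| > t) ≤ L₁(t) t^{-α} for all t > 0, such that for every δ > 0 there exist d, C > 0 with L₁(ts) ≤ C L₁(t) s^{δ} whenever t ≥ d and s ≥ 1. Define W(t) = max{sup_{w ≤ t} L₁(w), log t}. Let 0 < η < α and D > 2α/η, and assume E[|A|^α] < ∞ and E[|A|^α W(|A|)^D] < ∞. Then E[|B|^{α−η} |A|^{η}] < ∞. -/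
open MeasureTheory ProbabilityTheory Filter Set

noncomputable section

/-- The running majorant `t ↦ max{1, sup_{0 < w ≤ t} L w, log t}`. -/
def runningMajorant (L : ℝ → ℝ) (t : ℝ) : ℝ :=
  max 1 (max (sSup (L '' Set.Ioc (0:ℝ) t)) (Real.log t))

lemma one_le_runningMajorant (L : ℝ → ℝ) (t : ℝ) : 1 ≤ runningMajorant L t :=
  le_max_left _ _

lemma log_le_runningMajorant (L : ℝ → ℝ) (t : ℝ) : Real.log t ≤ runningMajorant L t :=
  (le_max_right _ _).trans (le_max_right _ _)

lemma le_runningMajorant {L : ℝ → ℝ} (hL : ∀ t > (0:ℝ), BddAbove (L '' Set.Ioc (0:ℝ) t))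
    {w t : ℝ} (hw : 0 < w) (hwt : w ≤ t) : L w ≤ runningMajorant L t :=
  (le_csSup (hL t (hw.trans_le hwt)) (mem_image_of_mem L ⟨hw, hwt⟩)).trans
    ((le_max_left _ _).trans (le_max_right _ _))

lemma runningMajorant_le {L : ℝ → ℝ} {t M : ℝ} (ht : 0 < t) (h1 : 1 ≤ M)
    (hL : ∀ w, 0 < w → w ≤ t → L w ≤ M) (hlog : Real.log t ≤ M) : runningMajorant L t ≤ M := by
  refine max_le h1 (max_le (csSup_le (Set.Nonempty.image _ ⟨t, ht, le_rfl⟩) ?_) hlog)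
  rintro _ ⟨w, hw, rfl⟩
  exact hL w hw.1 hw.2

lemma runningMajorant_mono {L : ℝ → ℝ} (hL : ∀ t > (0:ℝ), BddAbove (L '' Set.Ioc (0:ℝ) t))
    {s t : ℝ} (hs : 0 < s) (hst : s ≤ t) : runningMajorant L s ≤ runningMajorant L t :=
  runningMajorant_le hs (one_le_runningMajorant L t)
    (fun _ hw hws => le_runningMajorant hL hw (hws.trans hst))
    ((Real.log_le_log hs hst).trans (log_le_runningMajorant L t))

/-- A Potter-type bound for `L` beyond a threshold yields one for its running majorant on all of
`(0, ∞)`. -/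
lemma exists_runningMajorant_mul_le {L : ℝ → ℝ}
    (hL : ∀ t > (0:ℝ), BddAbove (L '' Set.Ioc (0:ℝ) t)) {δ : ℝ} (hδ : 0 < δ)
    (hpotter : ∃ d > (0:ℝ), ∃ C > (0:ℝ), ∀ t ≥ d, ∀ s ≥ (1:ℝ), L (t * s) ≤ C * L t * s ^ δ) :
    ∃ K > (0:ℝ), ∀ t > (0:ℝ), ∀ s ≥ (1:ℝ),
      runningMajorant L (t * s) ≤ K * runningMajorant L t * s ^ δ := by
  obtain ⟨d, hd, C, hC, hLC⟩ := hpotter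
  have hδ' : 0 < 1 / δ := by positivity
  have large : ∀ t ≥ d, ∀ s ≥ (1:ℝ),
      runningMajorant L (t * s) ≤ (1 + C + 1 / δ) * runningMajorant L t * s ^ δ := by
    intro t ht s hs
    have ht0 : 0 < t := hd.trans_le ht
    have hV := one_le_runningMajorant L t
    have hsδ : 1 ≤ s ^ δ := Real.one_le_rpow hs hδ.le
    have hP : 1 ≤ runningMajorant L t * s ^ δ := one_le_mul_of_one_le_of_one_le hV hsδ
    have hVP : runningMajorant L t ≤ runningMajorant L t * s ^ δ :=
      le_mul_of_one_le_right (by linarith) hsδ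
    have hsP : s ^ δ ≤ runningMajorant L t * s ^ δ := le_mul_of_one_le_left (by linarith) hV
    have hCP : 0 ≤ C * (runningMajorant L t * s ^ δ) := by positivity
    have hδP : 0 ≤ 1 / δ * (runningMajorant L t * s ^ δ) := by positivity
    refine runningMajorant_le (by positivity) (by linarith) (fun w hw hws => ?_) ?_
    · rcases le_total w t with hwt | hwt
      · linarith [le_runningMajorant hL hw hwt]
      · have h1 : 1 ≤ w / t := (one_le_div ht0).2 hwt
        have h2 : w / t ≤ s := (div_le_iff₀' ht0).2 hws
        have h3 := hLC t ht (w / t) h1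
        rw [mul_div_cancel₀ _ ht0.ne'] at h3
        have h4 : C * L t * (w / t) ^ δ ≤ C * runningMajorant L t * s ^ δ := by
          have := le_runningMajorant hL ht0 le_rfl
          gcongr
        linarith
    · rw [Real.log_mul ht0.ne' (by positivity)]
      have h1 : Real.log s ≤ s ^ δ / δ := Real.log_le_rpow_div (by linarith) hδ
      have h2 : s ^ δ / δ ≤ 1 / δ * (runningMajorant L t * s ^ δ) := by
        rw [div_eq_mul_one_div, mul_comm]
        gcongr
      linarith [log_le_runningMajorant L t]
  have hVd := one_le_runningMajorant L d
  refine ⟨(1 + C + 1 / δ) * runningMajorant L d, by positivity, fun t ht s hs => ?_⟩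
  have hV := one_le_runningMajorant L t
  have hsδ : 1 ≤ s ^ δ := Real.one_le_rpow hs hδ.le
  rcases le_total d t with hdt | hdt
  · refine (large t hdt s hs).trans ?_
    gcongr
    exact le_mul_of_one_le_right (by positivity) hVd
  · have key : runningMajorant L (t * s) ≤ (1 + C + 1 / δ) * runningMajorant L d * s ^ δ := by
      have hmono : t * s ≤ d * s := by gcongr
      exact (runningMajorant_mono hL (by positivity) hmono).trans (large d le_rfl s hs)
    refine key.trans (mul_le_mul_of_nonneg_right ?_ (by positivity))
    exact le_mul_of_one_le_right (by positivity) hV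

/-- If `P(|B| > t) ≤ V(t) t^{-α}` with `V ≥ max{1, log}` nondecreasing, then
`E[|B|^α V(|B|)^{-p}] < ∞` for every `p > 2`. -/
lemma lintegral_rpow_mul_rpow_neg_lt_top {Ω : Type*} [MeasurableSpace Ω] {μ : Measure Ω}
    [IsProbabilityMeasure μ] {B : Ω → ℝ} (hB : Measurable B) {α p : ℝ} (hα : 0 < α) (hp : 2 < p)
    {V : ℝ → ℝ} (hV1 : ∀ t, 1 ≤ V t) (hVlog : ∀ t, Real.log t ≤ V t)
    (hVmono : ∀ s t, 0 < s → s ≤ t → V s ≤ V t)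
    (htail : ∀ t > (0:ℝ), (μ {ω | t < |B ω|}).toReal ≤ V t * t ^ (-α)) :
    ∫⁻ ω, ENNReal.ofReal (|B ω| ^ α * V |B ω| ^ (-p)) ∂μ < ⊤ := by
  have hV0 : ∀ t, 0 < V t := fun t => one_pos.trans_le (hV1 t)
  let c : ℕ → ℝ := fun n => Real.exp (n + 1) ^ α * V (Real.exp n) ^ (-p)
  let S : ℕ → Set Ω := fun n => {ω | Real.exp n < |B ω|}
  have hS : ∀ n, MeasurableSet (S n) := fun n => measurableSet_lt measurable_const hB.abs
  have hc : ∀ n, 0 ≤ c n := fun n => by have := hV0 (Real.exp n); positivity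
  have pointwise : ∀ ω, ENNReal.ofReal (|B ω| ^ α * V |B ω| ^ (-p)) ≤
      1 + ∑' n, (S n).indicator (fun _ => ENNReal.ofReal (c n)) ω := by
    intro ω
    rcases le_or_gt |B ω| 1 with h | h
    · refine le_add_right ?_
      rw [ENNReal.ofReal_le_one]
      have h1 : |B ω| ^ α ≤ 1 := Real.rpow_le_one (abs_nonneg _) h hα.le
      have h2 : V |B ω| ^ (-p) ≤ 1 := Real.rpow_le_one_of_one_le_of_nonpos (hV1 _) (by linarith)
      exact mul_le_one₀ h1 (Real.rpow_nonneg (hV0 _).le _) h2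
    · have hlog : 0 < Real.log |B ω| := Real.log_pos h
      have hb : 0 < |B ω| := by linarith
      obtain ⟨m, hm⟩ := Nat.exists_eq_succ_of_ne_zero (Nat.ceil_pos.2 hlog).ne'
      have hlow : (m : ℝ) < Real.log |B ω| := Nat.lt_ceil.1 (by omega)
      have hup : Real.log |B ω| ≤ m + 1 := by
        have := Nat.le_ceil (Real.log |B ω|)
        rw [hm] at this
        exact_mod_cast this
      have hmem : ω ∈ S m := (Real.lt_log_iff_exp_lt hb).1 hlow
      have hble : |B ω| ≤ Real.exp (m + 1) := (Real.log_le_iff_le_exp hb).1 hup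
      refine le_add_left (le_trans ?_ (ENNReal.le_tsum m))
      rw [indicator_of_mem hmem]
      apply ENNReal.ofReal_le_ofReal
      refine mul_le_mul (Real.rpow_le_rpow hb.le hble hα.le) ?_
        (Real.rpow_nonneg (hV0 _).le _) (by positivity)
      exact Real.rpow_le_rpow_of_nonpos (hV0 _) (hVmono _ _ (Real.exp_pos _) (le_of_lt hmem))
        (by linarith)
  have hterm : ∀ n : ℕ, ENNReal.ofReal (c n) * μ (S n) ≤
      ENNReal.ofReal (Real.exp α * V (Real.exp n) ^ (1 - p)) := by
    intro n
    rw [← ENNReal.ofReal_toReal (measure_ne_top μ (S n)), ← ENNReal.ofReal_mul (hc n)]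
    apply ENNReal.ofReal_le_ofReal
    refine (mul_le_mul_of_nonneg_left (htail _ (Real.exp_pos _)) (hc n)).trans_eq ?_
    have e1 : V (Real.exp n) ^ (1 - p) = V (Real.exp n) * V (Real.exp n) ^ (-p) := by
      rw [sub_eq_add_neg, Real.rpow_add (hV0 _), Real.rpow_one]
    have e2 : Real.exp α = Real.exp (n + 1) ^ α * Real.exp n ^ (-α) := by
      rw [← Real.exp_mul, ← Real.exp_mul, ← Real.exp_add]
      ring_nf
    rw [e1, e2]
    ring
  have hsum : Summable fun n : ℕ => Real.exp α * V (Real.exp n) ^ (1 - p) := by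
    refine Summable.mul_left _ ?_
    have hs : Summable fun n : ℕ => (n : ℝ) ^ (1 - p) :=
      Real.summable_nat_rpow.2 (by linarith)
    rw [← summable_nat_add_iff 1] at hs ⊢
    refine Summable.of_nonneg_of_le (fun n => Real.rpow_nonneg (hV0 _).le _) (fun n => ?_) hs
    refine Real.rpow_le_rpow_of_nonpos (by positivity) ?_ (by linarith)
    simpa using hVlog (Real.exp ((n + 1 : ℕ) : ℝ))
  calc ∫⁻ ω, ENNReal.ofReal (|B ω| ^ α * V |B ω| ^ (-p)) ∂μ
      ≤ ∫⁻ ω, (1 + ∑' n, (S n).indicator (fun _ => ENNReal.ofReal (c n)) ω) ∂μ :=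
        lintegral_mono pointwise
    _ = 1 + ∑' n, ENNReal.ofReal (c n) * μ (S n) := by
        rw [lintegral_add_left measurable_const,
          lintegral_tsum fun n => (measurable_const.indicator (hS n)).aemeasurable]
        simp [lintegral_indicator_const (hS _)]
    _ ≤ 1 + ∑' n : ℕ, ENNReal.ofReal (Real.exp α * V (Real.exp n) ^ (1 - p)) := by
        gcongr with n
        exact hterm n
    _ < ⊤ := ENNReal.add_lt_top.2 ⟨ENNReal.one_lt_top, hsum.tsum_ofReal_lt_top⟩

/-- Splitting according to whether `b ≤ a V(a)^{D/α}`. -/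
lemma rpow_mul_rpow_le_add {V : ℝ → ℝ} (hV1 : ∀ t, 1 ≤ V t) {K α η δ D : ℝ} (hK : 0 < K)
    (hη : 0 < η) (hηα : η < α) (hδ : 0 < δ) (hD : 0 < D)
    (hV : ∀ t > (0:ℝ), ∀ s ≥ (1:ℝ), V (t * s) ≤ K * V t * s ^ δ)
    {a b : ℝ} (ha : 0 ≤ a) (hb : 0 ≤ b) :
    b ^ (α - η) * a ^ η ≤ a ^ α * V a ^ D +
      K ^ (η / (α / D + δ)) * (b ^ α * V b ^ (-(η / (α / D + δ)))) := by
  have hα : 0 < α := hη.trans hηα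
  have hVa := hV1 a
  have hVb := hV1 b
  have hVa0 : 0 < V a := by linarith
  have hVb0 : 0 < V b := by linarith
  rcases ha.eq_or_lt with rfl | ha
  · rw [Real.zero_rpow hη.ne', mul_zero]
    positivity
  rcases le_or_gt b (a * V a ^ (D / α)) with h | h
  · refine le_add_of_le_of_nonneg ?_ (by positivity)
    calc b ^ (α - η) * a ^ η ≤ (a * V a ^ (D / α)) ^ (α - η) * a ^ η := by
          gcongr
      _ = a ^ α * V a ^ (D / α * (α - η)) := by
          rw [Real.mul_rpow ha.le (by positivity), ← Real.rpow_mul hVa0.le, mul_right_comm,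
            ← Real.rpow_add ha, sub_add_cancel]
      _ ≤ a ^ α * V a ^ D := by
          gcongr
          rw [div_mul_eq_mul_div, div_le_iff₀ hα]
          nlinarith
  · refine le_add_of_nonneg_of_le (by positivity) ?_
    set q := α / D + δ with hq
    have hq0 : 0 < q := by positivity
    have hb0 : 0 < b := lt_of_le_of_lt (by positivity) h
    set s := b / a with hs
    have hs0 : 0 < s := by positivity
    have hbs : b = a * s := by rw [hs, mul_div_cancel₀ _ ha.ne']
    have hVs : V a ^ (D / α) ≤ s := (le_div_iff₀' ha).2 h.le
    have hs1 : 1 ≤ s := (Real.one_le_rpow hVa (by positivity)).trans hVs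
    have hVas : V a ≤ s ^ (α / D) := by
      have := Real.rpow_le_rpow (by positivity) hVs (show 0 ≤ α / D by positivity)
      rwa [← Real.rpow_mul hVa0.le, div_mul_div_cancel₀ hα.ne', div_self hD.ne',
        Real.rpow_one] at this
    have hVbs : V b ≤ K * s ^ q := by
      calc V b ≤ K * V a * s ^ δ := by
            rw [hbs]
            exact hV a ha s hs1
        _ ≤ K * s ^ (α / D) * s ^ δ := by gcongr
        _ = K * s ^ q := by rw [mul_assoc, ← Real.rpow_add hs0]
    have hVbs' : V b ^ (η / q) ≤ K ^ (η / q) * s ^ η := by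
      have := Real.rpow_le_rpow hVb0.le hVbs (show 0 ≤ η / q by positivity)
      rwa [Real.mul_rpow hK.le (by positivity), ← Real.rpow_mul hs0.le,
        mul_div_cancel₀ _ hq0.ne'] at this
    have e : b ^ (α - η) * a ^ η * s ^ η = b ^ α := by
      rw [mul_assoc, ← Real.mul_rpow ha.le hs0.le, ← hbs, ← Real.rpow_add hb0, sub_add_cancel]
    rw [Real.rpow_neg hVb0.le, ← mul_assoc, ← div_eq_mul_inv, le_div_iff₀ (by positivity)]
    calc b ^ (α - η) * a ^ η * V b ^ (η / q)
        ≤ b ^ (α - η) * a ^ η * (K ^ (η / q) * s ^ η) := by gcongr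
      _ = K ^ (η / q) * b ^ α := by rw [← e]; ring

/-- If `P(|B| > t) ≤ L₁(t) t^{−α}` with `L₁` locally bounded on `(0,∞)`
satisfying the Potter-type bound, `W(t) = max{sup_{0 < w ≤ t} L₁(w), log t}`, `0 < η < α`,
`D > 2α/η`, `E|A|^α < ∞` and `E[|A|^α W(|A|)^D] < ∞`, then `E[|B|^{α−η} |A|^η] < ∞`. -/
theorem moment_AB_finite
    {Ω : Type*} [MeasurableSpace Ω] (μ : Measure Ω) [IsProbabilityMeasure μ]
    (A B : Ω → ℝ)
    (hAmeas : Measurable A) (hBmeas : Measurable B)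
    (α : ℝ) (hα : 0 < α)
    (L₁ : ℝ → ℝ) (hL₁pos : ∀ t > (0:ℝ), 0 < L₁ t)
    (hL₁loc : ∀ t > (0:ℝ), BddAbove (L₁ '' Set.Ioc (0:ℝ) t))
    (hmod : ∀ t > (0:ℝ), (μ {ω | t < |B ω|}).toReal ≤ L₁ t * t ^ (-α))
    (hpotter : ∀ δ > (0:ℝ), ∃ d > (0:ℝ), ∃ C > (0:ℝ), ∀ t ≥ d, ∀ s ≥ (1:ℝ),
      L₁ (t * s) ≤ C * L₁ t * s ^ δ)
    -- W(t) = max{sup_{0 < w ≤ t} L₁(w), log t}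
    (W : ℝ → ℝ) (hW : ∀ t, W t = max (sSup (L₁ '' Set.Ioc (0:ℝ) t)) (Real.log t))
    (η D : ℝ) (hη : 0 < η) (hηα : η < α) (hD : 2 * α / η < D)
    (hAint : Integrable (fun ω => |A ω| ^ α) μ)
    (hAW : Integrable (fun ω => |A ω| ^ α * W |A ω| ^ D) μ) :
    Integrable (fun ω => |B ω| ^ (α - η) * |A ω| ^ η) μ := by
  have hD0 : 0 < D := lt_of_le_of_lt (by positivity) hD
  have hgap : α / D < η / 2 := by
    rw [div_lt_iff₀ hη] at hD
    rw [div_lt_iff₀ hD0]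
    linarith
  have hδ : 0 < (η / 2 - α / D) / 2 := by linarith
  generalize hδdef : (η / 2 - α / D) / 2 = δ at hδ
  obtain ⟨K, hK, hVK⟩ := exists_runningMajorant_mul_le hL₁loc hδ (hpotter δ hδ)
  have hq : 0 < α / D + δ := by positivity
  have hp : 2 < η / (α / D + δ) := by
    rw [lt_div_iff₀ hq]
    linarith
  have hpoint : ∀ ω, |B ω| ^ (α - η) * |A ω| ^ η ≤
      (|A ω| ^ α + ‖|A ω| ^ α * W |A ω| ^ D‖) + K ^ (η / (α / D + δ)) *
        (|B ω| ^ α * runningMajorant L₁ |B ω| ^ (-(η / (α / D + δ)))) := by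
    intro ω
    refine (rpow_mul_rpow_le_add (one_le_runningMajorant L₁) hK hη hηα hδ hD0 hVK
      (abs_nonneg _) (abs_nonneg _)).trans ?_
    gcongr
    have hVW : runningMajorant L₁ |A ω| = max 1 (W |A ω|) := by rw [hW, runningMajorant]
    have hα0 : 0 ≤ |A ω| ^ α := by positivity
    rw [hVW]
    rcases le_total (W |A ω|) 1 with h | h
    · rw [max_eq_left h, Real.one_rpow, mul_one]
      exact le_add_of_nonneg_right (norm_nonneg _)
    · rw [max_eq_right h]
      exact le_add_of_nonneg_of_le hα0 (Real.le_norm_self _)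
  have hGint : Integrable (fun ω => |A ω| ^ α + ‖|A ω| ^ α * W |A ω| ^ D‖) μ :=
    hAint.add hAW.norm
  have hBfin := lintegral_rpow_mul_rpow_neg_lt_top (μ := μ) hBmeas hα hp
    (one_le_runningMajorant L₁) (log_le_runningMajorant L₁)
    (fun _ _ => runningMajorant_mono hL₁loc) fun t ht =>
      (hmod t ht).trans (mul_le_mul_of_nonneg_right (le_runningMajorant hL₁loc ht le_rfl)
        (by positivity))
  refine ⟨((hBmeas.abs.pow_const _).mul (hAmeas.abs.pow_const _)).aestronglyMeasurable, ?_⟩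
  rw [hasFiniteIntegral_iff_ofReal (Eventually.of_forall fun ω => by positivity)]
  calc ∫⁻ ω, ENNReal.ofReal (|B ω| ^ (α - η) * |A ω| ^ η) ∂μ
      ≤ ∫⁻ ω, (ENNReal.ofReal (|A ω| ^ α + ‖|A ω| ^ α * W |A ω| ^ D‖) +
          ENNReal.ofReal (K ^ (η / (α / D + δ))) * ENNReal.ofReal
            (|B ω| ^ α * runningMajorant L₁ |B ω| ^ (-(η / (α / D + δ))))) ∂μ := by
        refine lintegral_mono fun ω => (ENNReal.ofReal_le_ofReal (hpoint ω)).trans ?_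
        rw [← ENNReal.ofReal_mul (by positivity)]
        exact ENNReal.ofReal_add_le
    _ < ⊤ := by
        rw [lintegral_add_left' hGint.aemeasurable.ennreal_ofReal,
          lintegral_const_mul' _ _ ENNReal.ofReal_ne_top]
        exact ENNReal.add_lt_top.2 ⟨hGint.lintegral_lt_top,
          ENNReal.mul_lt_top ENNReal.ofReal_lt_top hBfin⟩
end
end
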